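/- Let μ be a discrete positive Borel measure on ℝ whose support contains at least two points, let 𝓛 be an algebraic de Branges space with ∫_ℝ |F| dμ < ∞ for all F ∈ 𝓛 and F ↦ F|_ℝ injective from 𝓛 into L¹(μ), and let g₀ ∈ L^∞(μ) with |g₀| = 1 μ-a.e. be such that the closure of {F|_ℝ : F ∈ 𝓛} in L¹(μ) equals {f ∈ L¹(μ) : ∫_ℝ f·g₀ dμ = 0}. Let 𝔪(z) := sup{|F(z)| : F ∈ 𝓛, ‖F|_ℝ‖_{L¹(μ)} ≤ 1}, and define 𝒦 := { F entire : F|_ℝ ∈ L¹(μ), |F(iy)| = O(𝔪(iy)) as |y| → ∞, and there exists F₀ ∈ 𝓛 \ {0} such that F/F₀ is of bounded type on both ℂ⁺ and ℂ⁻ }. Then for every F ∈ 𝒦 with F not identically zero, the mean type τ_F := limsup_{y→+∞} (1/y) log(|F(iy)|/𝔪(iy)) satisfies −∞ < τ_F ≤ 0. -/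

import Mathlib

open Filter MeasureTheory
open scoped ENNReal NNReal

/-- An algebraic de Branges space: a linear space of entire functions, invariant
under division of zeros and under `F ↦ F^#`. -/
def IsAlgebraicDeBranges (L : Submodule ℂ (ℂ → ℂ)) : Prop :=
  (∀ F ∈ L, Differentiable ℂ F) ∧
  (∀ F ∈ L, ∀ w : ℂ, F w = 0 → ∃ G ∈ L, ∀ z : ℂ, z ≠ w → G z = F z / (z - w)) ∧
  (∀ F ∈ L, (fun z => (starRingEnd ℂ) (F ((starRingEnd ℂ) z))) ∈ L)

/-- The norm of the point evaluation at `z`: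
`𝔪(z) = sup {|F(z)| : F ∈ 𝓛, ‖F|_ℝ‖_{L¹(μ)} ≤ 1}`. -/
noncomputable def L1Majorant (μ : Measure ℝ) (L : Submodule ℂ (ℂ → ℂ)) (z : ℂ) : ℝ≥0∞ :=
  ⨆ F : {F : ℂ → ℂ // F ∈ L ∧ (∫⁻ x : ℝ, (‖F (x : ℂ)‖₊ : ℝ≥0∞) ∂μ) ≤ 1},
    (‖F.1 z‖₊ : ℝ≥0∞)

/-- The open upper half-plane. -/
def UpperHalf : Set ℂ := {z | 0 < z.im}

/-- The open lower half-plane. -/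
def LowerHalf : Set ℂ := {z | z.im < 0}

/-- The (possibly meromorphic) quotient `F/G` is of bounded type on `S`:
`F/G = g₁/g₂` with `g₁, g₂` bounded and holomorphic on `S` and `g₂` not
identically zero; the identity `F/G = g₁/g₂` is expressed as `F·g₂ = G·g₁` on `S`. -/
def BddTypeQuot (S : Set ℂ) (F G : ℂ → ℂ) : Prop :=
  ∃ g₁ g₂ : ℂ → ℂ, DifferentiableOn ℂ g₁ S ∧ DifferentiableOn ℂ g₂ S ∧
    (∃ C : ℝ, ∀ z ∈ S, ‖g₁ z‖ ≤ C) ∧ (∃ C : ℝ, ∀ z ∈ S, ‖g₂ z‖ ≤ C) ∧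
    (¬ ∀ z ∈ S, g₂ z = 0) ∧ (∀ z ∈ S, F z * g₂ z = G z * g₁ z)

/-- `μ` is a discrete measure: it lives on a countable set. -/
def IsDiscreteMeasure (μ : Measure ℝ) : Prop :=
  ∃ s : Set ℝ, s.Countable ∧ μ sᶜ = 0

/-- `x` belongs to the (topological) support of `μ`. -/
def MemSupport (μ : Measure ℝ) (x : ℝ) : Prop :=
  ∀ U ∈ nhds x, μ U ≠ 0

/-- Membership in the space `𝒦`: `F` entire, `F|_ℝ ∈ L¹(μ)`,
`|F(iy)| = O(𝔪(iy))` as `|y| → ∞`, and `F/F₀` of bounded type in both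
half-planes for some `F₀ ∈ 𝓛 \ {0}`. -/
def MemKcal (μ : Measure ℝ) (L : Submodule ℂ (ℂ → ℂ)) (F : ℂ → ℂ) : Prop :=
  Differentiable ℂ F ∧
  (∫⁻ x : ℝ, (‖F (x : ℂ)‖₊ : ℝ≥0∞) ∂μ) < ⊤ ∧
  (∃ C : ℝ≥0, ∀ᶠ (y : ℝ) in (atTop ⊔ atBot : Filter ℝ),
    (‖F ((y : ℂ) * Complex.I)‖₊ : ℝ≥0∞) ≤ C * L1Majorant μ L ((y : ℂ) * Complex.I)) ∧
  ∃ F₀ ∈ L, F₀ ≠ (0 : ℂ → ℂ) ∧ BddTypeQuot UpperHalf F F₀ ∧ BddTypeQuot LowerHalf F F₀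

/-- The Cauchy transform of the complex measure `φ μ`. -/
noncomputable def cauchyTransform (μ : Measure ℝ) (φ : ℝ → ℂ) (z : ℂ) : ℂ :=
  ∫ x, φ x * ((x : ℂ) - z)⁻¹ ∂μ

lemma im_le_norm_ofReal_sub (x : ℝ) (z : ℂ) : z.im ≤ ‖(x : ℂ) - z‖ := by
  have h := Complex.abs_im_le_norm ((x : ℂ) - z)
  simp only [Complex.sub_im, Complex.ofReal_im, zero_sub, abs_neg] at h
  exact (le_abs_self _).trans h

lemma norm_inv_ofReal_sub_le (x : ℝ) {z : ℂ} (hz : 0 < z.im) :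
    ‖((x : ℂ) - z)⁻¹‖ ≤ z.im⁻¹ := by
  rw [norm_inv]
  exact inv_anti₀ hz (im_le_norm_ofReal_sub x z)

lemma ofReal_sub_ne_zero (x : ℝ) {z : ℂ} (hz : 0 < z.im) : (x : ℂ) - z ≠ 0 :=
  norm_pos_iff.1 (hz.trans_le (im_le_norm_ofReal_sub x z))

lemma measurable_inv_ofReal_sub (z : ℂ) : Measurable fun x : ℝ => ((x : ℂ) - z)⁻¹ := by
  fun_prop

lemma integrable_mul_inv_ofReal_sub {μ : Measure ℝ} {φ : ℝ → ℂ} (hφ : Integrable φ μ)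
    {z : ℂ} (hz : 0 < z.im) : Integrable (fun x : ℝ => φ x * ((x : ℂ) - z)⁻¹) μ :=
  hφ.mul_bdd (c := z.im⁻¹) (measurable_inv_ofReal_sub z).aestronglyMeasurable
    (ae_of_all _ fun x => norm_inv_ofReal_sub_le x hz)

lemma norm_cauchyTransform_le {μ : Measure ℝ} {φ : ℝ → ℂ} (hφ : Integrable φ μ)
    {z : ℂ} (hz : 0 < z.im) : ‖cauchyTransform μ φ z‖ ≤ (∫ x, ‖φ x‖ ∂μ) * z.im⁻¹ := by
  rw [← integral_mul_const]
  refine norm_integral_le_of_norm_le (hφ.norm.mul_const _) (ae_of_all _ fun x => ?_)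
  rw [norm_mul]
  gcongr
  exact norm_inv_ofReal_sub_le x hz

lemma differentiableAt_cauchyTransform {μ : Measure ℝ} {φ : ℝ → ℂ} (hφ : Integrable φ μ)
    {z : ℂ} (hz : 0 < z.im) : DifferentiableAt ℂ (cauchyTransform μ φ) z := by
  have hs : {u : ℂ | z.im / 2 < u.im} ∈ nhds z :=
    (isOpen_lt continuous_const Complex.continuous_im).mem_nhds (half_lt_self hz)
  have hpos : ∀ u ∈ {u : ℂ | z.im / 2 < u.im}, 0 < u.im := fun u hu => (half_pos hz).trans hu
  refine (hasDerivAt_integral_of_dominated_loc_of_deriv_le (𝕜 := ℂ) (μ := μ)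
    (F := fun u x => φ x * ((x : ℂ) - u)⁻¹) (F' := fun u x => φ x * (((x : ℂ) - u) ^ 2)⁻¹)
    (bound := fun x => ‖φ x‖ * ((z.im / 2) ^ 2)⁻¹) hs ?_
    (integrable_mul_inv_ofReal_sub hφ hz) ?_ ?_ (hφ.norm.mul_const _) ?_).2.differentiableAt
  · exact Eventually.of_forall fun u => hφ.aestronglyMeasurable.mul
      (measurable_inv_ofReal_sub u).aestronglyMeasurable
  · exact hφ.aestronglyMeasurable.mul
      (by fun_prop : Measurable fun x : ℝ => (((x : ℂ) - z) ^ 2)⁻¹).aestronglyMeasurable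
  · refine ae_of_all _ fun x u hu => ?_
    rw [norm_mul, norm_inv, norm_pow]
    have : z.im / 2 ≤ ‖(x : ℂ) - u‖ := (le_of_lt hu).trans (im_le_norm_ofReal_sub x u)
    gcongr
  · refine ae_of_all _ fun x u hu => ?_
    have h := ((hasDerivAt_id u).const_sub (x : ℂ)).inv (ofReal_sub_ne_zero x (hpos u hu))
    simpa [div_eq_mul_inv] using h.const_mul (φ x)

/-- A neighbourhood of a point in the support of a discrete measure contains an atom. -/
lemma exists_atom_mem_of_memSupport {μ : Measure ℝ} (hdisc : IsDiscreteMeasure μ) {a : ℝ}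
    (ha : MemSupport μ a) {U : Set ℝ} (hU : U ∈ nhds a) : ∃ x ∈ U, μ {x} ≠ 0 := by
  obtain ⟨s, hs, hs0⟩ := hdisc
  by_contra! h
  refine ha U hU (measure_mono_null (t := (U ∩ s) ∪ sᶜ) (fun x hx => ?_)
    (measure_union_null ?_ hs0))
  · by_cases hxs : x ∈ s
    · exact Or.inl ⟨hx, hxs⟩
    · exact Or.inr hxs
  · rw [← Set.biUnion_of_singleton (U ∩ s), measure_biUnion_null_iff
      (hs.mono Set.inter_subset_right)]
    exact fun x hx => h x hx.1

lemma exists_two_atoms {μ : Measure ℝ} (hdisc : IsDiscreteMeasure μ)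
    (hsupp : ∃ a b : ℝ, a ≠ b ∧ MemSupport μ a ∧ MemSupport μ b) :
    ∃ a b : ℝ, a ≠ b ∧ μ {a} ≠ 0 ∧ μ {b} ≠ 0 := by
  obtain ⟨a, b, hab, ha, hb⟩ := hsupp
  obtain ⟨U, hU, V, hV, hUV⟩ := Filter.disjoint_iff.1 (disjoint_nhds_nhds.2 hab)
  obtain ⟨x, hxU, hx⟩ := exists_atom_mem_of_memSupport hdisc ha hU
  obtain ⟨y, hyV, hy⟩ := exists_atom_mem_of_memSupport hdisc hb hV
  exact ⟨x, y, fun h => Set.disjoint_left.1 hUV hxU (h ▸ hyV), hx, hy⟩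

/-- If every integrable function annihilated by `g₀` is also annihilated by `ψ g₀`, then `ψ`
takes the same value at any two atoms. -/
lemma eq_of_annihilates {μ : Measure ℝ} [IsLocallyFiniteMeasure μ] {g₀ ψ : ℝ → ℂ}
    (hg₀u : ∀ᵐ x ∂μ, ‖g₀ x‖ = 1)
    (h : ∀ f : ℝ → ℂ, Integrable f μ → ∫ x, f x * g₀ x ∂μ = 0 →
      ∫ x, f x * g₀ x * ψ x ∂μ = 0)
    {a b : ℝ} (ha : μ {a} ≠ 0) (hb : μ {b} ≠ 0) (hab : a ≠ b) : ψ a = ψ b := by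
  have hg : ∀ c : ℝ, μ {c} ≠ 0 → g₀ c ≠ 0 := fun c hc h0 => by
    refine hc (measure_mono_null (fun x hx => ?_) (ae_iff.1 hg₀u))
    rw [Set.mem_singleton_iff.1 hx]
    simp [h0]
  have hfin : ∀ c : ℝ, μ {c} ≠ ⊤ := fun c => isCompact_singleton.measure_lt_top.ne
  have hm : ∀ c : ℝ, μ {c} ≠ 0 → (μ.real {c} : ℂ) ≠ 0 := fun c hc => by
    exact_mod_cast (ENNReal.toReal_pos hc (hfin c)).ne'
  set α : ℂ := μ.real {b} * g₀ b
  set β : ℂ := -(μ.real {a} * g₀ a)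
  let f : ℝ → ℂ := fun x => ({a} : Set ℝ).indicator (fun _ => α) x
    + ({b} : Set ℝ).indicator (fun _ => β) x
  have hind : ∀ (c : ℝ) (γ : ℂ), Integrable (({c} : Set ℝ).indicator (fun _ => γ)) μ :=
    fun c γ => (integrable_indicator_iff (measurableSet_singleton c)).2
      (integrableOn_const (hfin c))
  have hf : Integrable f μ := (hind a α).add (hind b β)
  have hint : ∀ φ : ℝ → ℂ, ∫ x, f x * φ x ∂μ
      = μ.real {a} * (α * φ a) + μ.real {b} * (β * φ b) := fun φ => by
    have : (fun x => f x * φ x) = fun x => ({a} : Set ℝ).indicator (fun _ => α * φ a) x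
        + ({b} : Set ℝ).indicator (fun _ => β * φ b) x := by
      ext x
      by_cases hxa : x = a
      · subst hxa; simp [f, hab]
      · by_cases hxb : x = b
        · subst hxb; simp [f, hxa]
        · simp [f, hxa, hxb]
    rw [this, integral_add (hind _ _) (hind _ _),
      integral_indicator_const _ (measurableSet_singleton a),
      integral_indicator_const _ (measurableSet_singleton b)]
    simp
  have h1 := h f hf (by rw [hint]; simp only [α, β]; ring)
  simp only [mul_assoc] at h1
  rw [hint (fun x => g₀ x * ψ x)] at h1
  have h2 : (μ.real {a} : ℂ) * μ.real {b} * (g₀ a * g₀ b) * (ψ a - ψ b) = 0 := by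
    rw [← h1]; simp only [α, β]; ring
  exact sub_eq_zero.1 ((mul_eq_zero.1 h2).resolve_left
    (mul_ne_zero (mul_ne_zero (hm a ha) (hm b hb)) (mul_ne_zero (hg a ha) (hg b hb))))

/-- A bounded holomorphic function in a half-plane that decays superexponentially along the
imaginary half-axis vanishes on a smaller half-plane. -/
lemma eq_zero_of_superexponential_decay {H : ℂ → ℂ}
    (hd : ∀ z : ℂ, 0 < z.im → DifferentiableAt ℂ H z)
    {B : ℝ} (hB : ∀ z : ℂ, 1 ≤ z.im → ‖H z‖ ≤ B)
    {M : ℝ} (hdec : ∀ c : ℝ, ∀ᶠ y : ℝ in atTop, ‖H (y * Complex.I)‖ ≤ M * Real.exp (-c * y)) :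
    ∀ z : ℂ, 1 ≤ z.im → H z = 0 := by
  set f : ℂ → ℂ := fun z => H (Complex.I * (z + 1)) with hf
  have him : ∀ z : ℂ, (Complex.I * (z + 1)).im = z.re + 1 := fun z => by simp
  have hfd : ∀ z : ℂ, 0 ≤ z.re → DifferentiableAt ℂ f z := fun z hz =>
    (hd _ (by rw [him]; positivity)).comp z (by fun_prop)
  have hfB : ∀ z : ℂ, 0 ≤ z.re → ‖f z‖ ≤ B := fun z hz => hB _ (by rw [him]; linarith)
  have key := PhragmenLindelof.eq_zero_on_right_half_plane_of_superexponential_decay (f := f)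
    ?_ ?_ ?_ ?_
  · intro z hz
    have := key (x := -Complex.I * z - 1) (by simpa using hz)
    have h2 : Complex.I * (-Complex.I * z - 1 + 1) = z := by
      linear_combination (-z) * Complex.I_sq
    simpa only [hf, h2, Pi.zero_apply] using this
  · refine DifferentiableOn.diffContOnCl fun z hz => (hfd z ?_).differentiableWithinAt
    rwa [Complex.closure_setOfPred_lt_re] at hz
  · refine ⟨0, by norm_num, 0, Asymptotics.IsBigO.of_bound B ?_⟩
    refine eventually_inf_principal.2 (Eventually.of_forall fun z hz => ?_)
    simpa using hfB z (le_of_lt hz)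
  · intro n
    have hM : Tendsto (fun x : ℝ => |M| * Real.exp (-x)) atTop (nhds 0) := by
      simpa using (Real.tendsto_exp_neg_atTop_nhds_zero).const_mul |M|
    refine squeeze_zero' (Eventually.of_forall fun x => by positivity) ?_ hM
    have hshift : Tendsto (fun x : ℝ => x + 1) atTop atTop :=
      tendsto_atTop_add_const_right _ _ tendsto_id
    filter_upwards [hshift.eventually (hdec (n + 1)), eventually_ge_atTop 0] with x hx hx0
    have h1 : f x = H (((x + 1 : ℝ) : ℂ) * Complex.I) := by
      simp only [hf]; congr 1; push_cast; ring
    rw [h1, ← Real.exp_nat_mul]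
    calc Real.exp (n * x) * _ ≤ Real.exp (n * x) * (|M| * Real.exp (-((n : ℝ) + 1) * (x + 1))) := by
          gcongr
          exact hx.trans (by gcongr; exact le_abs_self M)
      _ = |M| * Real.exp (n * x + -((n : ℝ) + 1) * (x + 1)) := by rw [Real.exp_add]; ring
      _ ≤ |M| * Real.exp (-x) := by
          gcongr
          nlinarith [(Nat.cast_nonneg n : (0 : ℝ) ≤ n)]
  · exact ⟨B, fun x => hfB _ (by simp)⟩

lemma integrable_mul_unimodular {μ : Measure ℝ} {g₀ f : ℝ → ℂ} (hg₀m : Measurable g₀)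
    (hg₀u : ∀ᵐ x ∂μ, ‖g₀ x‖ = 1) (hf : Integrable f μ) :
    Integrable (fun x => f x * g₀ x) μ :=
  hf.mul_bdd (c := 1) hg₀m.aestronglyMeasurable (hg₀u.mono fun _ h => h.le)

lemma integral_norm_mul_unimodular {μ : Measure ℝ} {g₀ : ℝ → ℂ}
    (hg₀u : ∀ᵐ x ∂μ, ‖g₀ x‖ = 1) (f : ℝ → ℂ) :
    ∫ x, ‖f x * g₀ x‖ ∂μ = ∫ x, ‖f x‖ ∂μ :=
  integral_congr_ae (hg₀u.mono fun x h => by simp [h])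

lemma integrable_restrict_real {μ : Measure ℝ} {F : ℂ → ℂ} (hF : Differentiable ℂ F)
    (hF1 : (∫⁻ x : ℝ, (‖F (x : ℂ)‖₊ : ℝ≥0∞) ∂μ) < ⊤) :
    Integrable (fun x : ℝ => F (x : ℂ)) μ :=
  ⟨(hF.continuous.comp Complex.continuous_ofReal).measurable.aestronglyMeasurable, hF1⟩

/-- If `g₀` annihilates `L`, then `F(w) ∫ G g₀ / (x - w) = G(w) ∫ F g₀ / (x - w)`. -/
lemma mul_cauchyTransform_comm {μ : Measure ℝ} {L : Submodule ℂ (ℂ → ℂ)}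
    (hdb : IsAlgebraicDeBranges L) {g₀ : ℝ → ℂ}
    (hI : ∀ F ∈ L, Integrable (fun x : ℝ => F (x : ℂ) * g₀ x) μ)
    (hann : ∀ F ∈ L, ∫ x : ℝ, F (x : ℂ) * g₀ x ∂μ = 0)
    {F G : ℂ → ℂ} (hF : F ∈ L) (hG : G ∈ L) {w : ℂ} (hw : 0 < w.im) :
    F w * cauchyTransform μ (fun x : ℝ => G (x : ℂ) * g₀ x) w
      = G w * cauchyTransform μ (fun x : ℝ => F (x : ℂ) * g₀ x) w := by
  obtain ⟨N, hN, hNz⟩ := hdb.2.1 (F w • G - G w • F)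
    (L.sub_mem (L.smul_mem _ hG) (L.smul_mem _ hF)) w (by simp [mul_comm])
  have h0 := hann N hN
  rw [← sub_eq_zero, ← h0, cauchyTransform, cauchyTransform, ← integral_const_mul,
    ← integral_const_mul, ← integral_sub
      ((integrable_mul_inv_ofReal_sub (hI G hG) hw).const_mul _)
      ((integrable_mul_inv_ofReal_sub (hI F hF) hw).const_mul _)]
  congr 1
  ext x
  rw [hNz x (sub_ne_zero.1 (ofReal_sub_ne_zero x hw))]
  simp only [Pi.sub_apply, Pi.smul_apply, smul_eq_mul, div_eq_mul_inv]
  ring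

/-- If `g₀` annihilates `L`, the Cauchy transform of `F g₀` vanishes at the zeros of `F`. -/
lemma cauchyTransform_eq_zero_of_apply_eq_zero {μ : Measure ℝ} {L : Submodule ℂ (ℂ → ℂ)}
    (hdb : IsAlgebraicDeBranges L) {g₀ : ℝ → ℂ}
    (hann : ∀ F ∈ L, ∫ x : ℝ, F (x : ℂ) * g₀ x ∂μ = 0)
    {F : ℂ → ℂ} (hF : F ∈ L) {w : ℂ} (hw : 0 < w.im) (hFw : F w = 0) :
    cauchyTransform μ (fun x : ℝ => F (x : ℂ) * g₀ x) w = 0 := by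
  obtain ⟨N, hN, hNz⟩ := hdb.2.1 F hF w hFw
  rw [← hann N hN, cauchyTransform]
  congr 1
  ext x
  rw [hNz x (sub_ne_zero.1 (ofReal_sub_ne_zero x hw))]
  ring

/-- Some element of `L` has a nonzero Cauchy transform at a given point of the upper
half-plane. -/
lemma exists_cauchyTransform_ne_zero {μ : Measure ℝ} [IsLocallyFiniteMeasure μ]
    (hdisc : IsDiscreteMeasure μ)
    (hsupp : ∃ a b : ℝ, a ≠ b ∧ MemSupport μ a ∧ MemSupport μ b)
    {L : Submodule ℂ (ℂ → ℂ)} {g₀ : ℝ → ℂ} (hg₀m : Measurable g₀)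
    (hg₀u : ∀ᵐ x ∂μ, ‖g₀ x‖ = 1)
    (hL : ∀ F ∈ L, Integrable (fun x : ℝ => F (x : ℂ)) μ)
    (hdense : ∀ f : ℝ → ℂ, Integrable f μ → ∫ x, f x * g₀ x ∂μ = 0 →
      ∀ ε : ℝ, 0 < ε → ∃ F ∈ L, (∫⁻ x : ℝ, (‖f x - F (x : ℂ)‖₊ : ℝ≥0∞) ∂μ) < ENNReal.ofReal ε)
    {w : ℂ} (hw : 0 < w.im) :
    ∃ G ∈ L, cauchyTransform μ (fun x : ℝ => G (x : ℂ) * g₀ x) w ≠ 0 := by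
  by_contra! h
  obtain ⟨a, b, hab, ha, hb⟩ := exists_two_atoms hdisc hsupp
  have hψ := eq_of_annihilates (ψ := fun x : ℝ => ((x : ℂ) - w)⁻¹) hg₀u ?_ ha hb hab
  · exact hab (by simpa using hψ)
  intro f hf hf0
  change cauchyTransform μ (fun x => f x * g₀ x) w = 0
  refine norm_le_zero_iff.1 (le_of_forall_pos_le_add fun ε hε => ?_)
  obtain ⟨F, hF, hlt⟩ := hdense f hf hf0 (ε * w.im) (by positivity)
  have hfF : Integrable (fun x : ℝ => f x - F (x : ℂ)) μ := hf.sub (hL F hF)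
  have hsub : cauchyTransform μ (fun x => f x * g₀ x) w
      = cauchyTransform μ (fun x => (f x - F (x : ℂ)) * g₀ x) w := by
    have h0 := h F hF
    rw [← sub_zero (cauchyTransform μ (fun x => f x * g₀ x) w), ← h0]
    simp only [cauchyTransform]
    rw [← integral_sub
      (integrable_mul_inv_ofReal_sub (integrable_mul_unimodular hg₀m hg₀u hf) hw)
      (integrable_mul_inv_ofReal_sub (integrable_mul_unimodular hg₀m hg₀u (hL F hF)) hw)]
    congr 1
    ext x
    ring
  have hnorm : ∫ x, ‖f x - F (x : ℂ)‖ ∂μ ≤ ε * w.im := by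
    rw [integral_norm_eq_lintegral_enorm hfF.aestronglyMeasurable]
    exact ENNReal.toReal_le_of_le_ofReal (by positivity) hlt.le
  rw [hsub, zero_add]
  refine (norm_cauchyTransform_le (integrable_mul_unimodular hg₀m hg₀u hfF) hw).trans ?_
  rw [integral_norm_mul_unimodular hg₀u, ← div_eq_mul_inv, div_le_iff₀ hw]
  exact hnorm

/-- The majorant is controlled by a single function through its Cauchy transform. -/
lemma enorm_cauchyTransform_mul_L1Majorant_le {μ : Measure ℝ} {L : Submodule ℂ (ℂ → ℂ)}
    (hdb : IsAlgebraicDeBranges L) {g₀ : ℝ → ℂ} (hg₀m : Measurable g₀)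
    (hg₀u : ∀ᵐ x ∂μ, ‖g₀ x‖ = 1)
    (hL : ∀ F ∈ L, Integrable (fun x : ℝ => F (x : ℂ)) μ)
    (hann : ∀ F ∈ L, ∫ x : ℝ, F (x : ℂ) * g₀ x ∂μ = 0)
    {F : ℂ → ℂ} (hF : F ∈ L) {w : ℂ} (hw : 0 < w.im) :
    ENNReal.ofReal ‖cauchyTransform μ (fun x : ℝ => F (x : ℂ) * g₀ x) w‖ * L1Majorant μ L w
      ≤ ENNReal.ofReal (‖F w‖ * w.im⁻¹) := by
  rw [L1Majorant, ENNReal.mul_iSup]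
  refine iSup_le fun ⟨G, hG, hG1⟩ => ?_
  have hI := fun F hF => integrable_mul_unimodular hg₀m hg₀u (hL F hF)
  have hG1' : ∫ x : ℝ, ‖G (x : ℂ)‖ ∂μ ≤ 1 := by
    rw [integral_norm_eq_lintegral_enorm (hL G hG).aestronglyMeasurable]
    exact ENNReal.toReal_le_of_le_ofReal zero_le_one (hG1.trans_eq ENNReal.ofReal_one.symm)
  have hC := norm_cauchyTransform_le (hI G hG) hw
  rw [integral_norm_mul_unimodular hg₀u] at hC
  change _ * ‖G w‖ₑ ≤ _
  rw [← ofReal_norm, ← ENNReal.ofReal_mul (norm_nonneg _), mul_comm ‖cauchyTransform _ _ _‖,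
    ← norm_mul, ← mul_cauchyTransform_comm hdb hI hann hF hG hw, norm_mul]
  refine ENNReal.ofReal_le_ofReal ?_
  gcongr
  exact hC.trans (mul_le_of_le_one_left (by positivity) hG1')

lemma analyticOnNhd_upperHalf {f : ℂ → ℂ} (hf : ∀ z : ℂ, 0 < z.im → DifferentiableAt ℂ f z) :
    AnalyticOnNhd ℂ f UpperHalf :=
  DifferentiableOn.analyticOnNhd (fun z hz => (hf z hz).differentiableWithinAt)
    (isOpen_lt continuous_const Complex.continuous_im)

lemma isPreconnected_upperHalf : IsPreconnected UpperHalf :=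
  (convex_halfSpace_im_gt 0).isPreconnected

/-- The identity theorem for a product of holomorphic functions on the upper half-plane. -/
lemma eq_zero_or_eq_zero_of_mul_eq_zero_on_upperHalf {f g : ℂ → ℂ}
    (hf : ∀ z : ℂ, 0 < z.im → DifferentiableAt ℂ f z)
    (hg : ∀ z : ℂ, 0 < z.im → DifferentiableAt ℂ g z)
    (h : ∀ z : ℂ, 0 < z.im → f z * g z = 0) :
    (∀ z : ℂ, 0 < z.im → f z = 0) ∨ (∀ z : ℂ, 0 < z.im → g z = 0) :=
  (analyticOnNhd_upperHalf hf).eq_zero_or_eq_zero_of_mul_eq_zero (analyticOnNhd_upperHalf hg) h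
    isPreconnected_upperHalf

lemma eventually_le_im {z : ℂ} {c : ℝ} (hz : c < z.im) : ∀ᶠ u in nhds z, c ≤ u.im :=
  (Complex.continuous_im.tendsto z).eventually_const_le hz

lemma eq_zero_on_upperHalf_of_eq_zero {f : ℂ → ℂ}
    (hf : ∀ z : ℂ, 0 < z.im → DifferentiableAt ℂ f z) (h : ∀ z : ℂ, 1 ≤ z.im → f z = 0) :
    ∀ z : ℂ, 0 < z.im → f z = 0 := by
  refine (analyticOnNhd_upperHalf hf).eqOn_zero_of_preconnected_of_eventuallyEq_zero
    isPreconnected_upperHalf (z₀ := 2 * Complex.I) (by simp [UpperHalf]) ?_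
  exact (eventually_le_im (c := 1) (by simp)).mono fun u hu => h u hu

lemma eq_zero_of_eq_zero_on_upperHalf {F : ℂ → ℂ} (hF : Differentiable ℂ F)
    (h : ∀ z : ℂ, 0 < z.im → F z = 0) : F = 0 := by
  have hA : AnalyticOnNhd ℂ F Set.univ := hF.differentiableOn.analyticOnNhd isOpen_univ
  refine hA.eq_of_eventuallyEq (z₀ := 2 * Complex.I) (fun _ _ => analyticAt_const) ?_
  exact (eventually_le_im (c := 1) (by simp)).mono fun u hu =>
    h u (zero_lt_one.trans_le hu)

lemma limsup_inv_mul_log_nonpos {r : ℝ → ℝ≥0∞} {C : ℝ≥0}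
    (h : ∀ᶠ y : ℝ in atTop, r y ≤ C) :
    limsup (fun y : ℝ => ((y⁻¹ : ℝ) : EReal) * ENNReal.log (r y)) atTop ≤ 0 := by
  have hC : (1 : ℝ) ≤ max (C : ℝ) 1 := le_max_right _ _
  have hlim : Tendsto (fun y : ℝ => ((y⁻¹ * Real.log (max (C : ℝ) 1) : ℝ) : EReal)) atTop (nhds 0) := by
    have := tendsto_inv_atTop_zero.mul_const (Real.log (max (C : ℝ) 1))
    rw [zero_mul] at this
    exact (continuous_coe_real_ereal.tendsto 0).comp this
  rw [← hlim.limsup_eq]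
  refine limsup_le_limsup ?_
  filter_upwards [h, eventually_gt_atTop 0] with y hy hy0
  rw [EReal.coe_mul]
  refine mul_le_mul_of_nonneg_left ?_ (EReal.coe_nonneg.2 (inv_pos.2 hy0).le)
  rw [← ENNReal.log_ofReal_of_pos (zero_lt_one.trans_le hC)]
  refine ENNReal.log_le_log (hy.trans ?_)
  rw [← ENNReal.ofReal_coe_nnreal]
  exact ENNReal.ofReal_le_ofReal (le_max_left _ _)

lemma eventually_le_exp_of_limsup_eq_bot {r : ℝ → ℝ≥0∞}
    (h : limsup (fun y : ℝ => ((y⁻¹ : ℝ) : EReal) * ENNReal.log (r y)) atTop = ⊥) (c : ℝ) :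
    ∀ᶠ y : ℝ in atTop, r y ≤ ENNReal.ofReal (Real.exp (-c * y)) := by
  have hlt := eventually_lt_of_limsup_lt (h.trans_lt (EReal.bot_lt_coe (-c)))
  filter_upwards [hlt, eventually_gt_atTop 0] with y hy hy0
  by_contra! hr
  refine hy.not_ge ?_
  have h1 := (ENNReal.log_lt_log hr).le
  rw [ENNReal.log_ofReal_of_pos (Real.exp_pos _), Real.log_exp] at h1
  calc ((-c : ℝ) : EReal) = ((y⁻¹ : ℝ) : EReal) * ((-c * y : ℝ) : EReal) := by
        rw [← EReal.coe_mul]; congr 1; field_simp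
    _ ≤ _ := mul_le_mul_of_nonneg_left h1 (EReal.coe_nonneg.2 (inv_pos.2 hy0).le)

/-- For every `F ∈ 𝒦`, `F` not identically zero, the mean type
`τ_F = limsup_{y→+∞} (1/y)·log(|F(iy)|/𝔪(iy))` satisfies `-∞ < τ_F ≤ 0`
(the logarithm is taken in the extended sense). -/
theorem stmt17 (μ : MeasureTheory.Measure ℝ) [MeasureTheory.IsLocallyFiniteMeasure μ]
    (hdisc : IsDiscreteMeasure μ)
    (hsupp : ∃ a b : ℝ, a ≠ b ∧ MemSupport μ a ∧ MemSupport μ b)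
    (L : Submodule ℂ (ℂ → ℂ)) (hdb : IsAlgebraicDeBranges L)
    (hint : ∀ F ∈ L, (∫⁻ x : ℝ, (‖F (x : ℂ)‖₊ : ℝ≥0∞) ∂μ) < ⊤)
    (hinj : ∀ F ∈ L, ∀ G ∈ L, (fun x : ℝ => F (x : ℂ)) =ᵐ[μ] (fun x : ℝ => G (x : ℂ)) → F = G)
    (g₀ : ℝ → ℂ) (hg₀m : Measurable g₀) (hg₀u : ∀ᵐ x ∂μ, ‖g₀ x‖ = 1)
    (hclos : ∀ f : ℝ → ℂ, MeasureTheory.Integrable f μ →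
      ((∀ ε : ℝ, 0 < ε → ∃ F ∈ L,
          (∫⁻ x : ℝ, (‖f x - F (x : ℂ)‖₊ : ℝ≥0∞) ∂μ) < ENNReal.ofReal ε) ↔
        ∫ x, f x * g₀ x ∂μ = 0)) :
    ∀ F : ℂ → ℂ, MemKcal μ L F → F ≠ 0 →
      (⊥ : EReal) <
          Filter.limsup (fun y : ℝ => ((y⁻¹ : ℝ) : EReal) *
            ENNReal.log ((‖F ((y : ℂ) * Complex.I)‖₊ : ℝ≥0∞) /
              L1Majorant μ L ((y : ℂ) * Complex.I))) atTop ∧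
        Filter.limsup (fun y : ℝ => ((y⁻¹ : ℝ) : EReal) *
            ENNReal.log ((‖F ((y : ℂ) * Complex.I)‖₊ : ℝ≥0∞) /
              L1Majorant μ L ((y : ℂ) * Complex.I))) atTop ≤ 0 := by
  rintro F ⟨hFd, -, ⟨C, hC⟩, F₀, hF₀, hF₀0, ⟨g₁, g₂, hg₁, hg₂, ⟨B₁, hB₁⟩, ⟨B₂, hB₂⟩, hg₂0, hq⟩, -⟩
    hF0
  have hC' := (eventually_sup.1 hC).1
  refine ⟨?_, limsup_inv_mul_log_nonpos (C := C) (hC'.mono fun y hy => ENNReal.div_le_of_le_mul hy)⟩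
  rw [bot_lt_iff_ne_bot]
  intro hbot
  have hL : ∀ F ∈ L, Integrable (fun x : ℝ => F (x : ℂ)) μ := fun F hF =>
    integrable_restrict_real (hdb.1 F hF) (hint F hF)
  have hI := fun F hF => integrable_mul_unimodular hg₀m hg₀u (hL F hF)
  have hann : ∀ F ∈ L, ∫ x : ℝ, F (x : ℂ) * g₀ x ∂μ = 0 := fun F hF =>
    (hclos _ (hL F hF)).1 fun ε hε => ⟨F, hF, by simpa using hε⟩
  set T : ℂ → ℂ := cauchyTransform μ (fun x : ℝ => F₀ (x : ℂ) * g₀ x) with hT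
  have hTd : ∀ z : ℂ, 0 < z.im → DifferentiableAt ℂ T z := fun z hz =>
    differentiableAt_cauchyTransform (hI F₀ hF₀) hz
  have hopen : IsOpen UpperHalf := isOpen_lt continuous_const Complex.continuous_im
  have hg₁d : ∀ z : ℂ, 0 < z.im → DifferentiableAt ℂ g₁ z := fun z hz =>
    hg₁.differentiableAt (hopen.mem_nhds hz)
  have hT0 : ¬ ∀ z : ℂ, 0 < z.im → T z = 0 := fun h => by
    refine hF₀0 (eq_zero_of_eq_zero_on_upperHalf (hdb.1 F₀ hF₀) fun z hz => ?_)
    obtain ⟨G, hG, hGz⟩ := exists_cauchyTransform_ne_zero hdisc hsupp hg₀m hg₀u hL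
      (fun f hf => (hclos f hf).2) hz
    have := mul_cauchyTransform_comm hdb hI hann hF₀ hG hz
    rw [← hT, h z hz, mul_zero] at this
    exact (mul_eq_zero.1 this).resolve_right hGz
  have hg₁0 : ¬ ∀ z : ℂ, 0 < z.im → g₁ z = 0 := fun h => by
    rcases eq_zero_or_eq_zero_of_mul_eq_zero_on_upperHalf (fun z _ => hFd z)
      (fun z hz => hg₂.differentiableAt (hopen.mem_nhds hz))
      (fun z hz => by rw [hq z hz, h z hz, mul_zero]) with h' | h'
    exacts [hF0 (eq_zero_of_eq_zero_on_upperHalf hFd h'), hg₂0 h']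
  have hB₁0 : 0 ≤ B₁ := (norm_nonneg _).trans (hB₁ Complex.I (by simp [UpperHalf]))
  have hB₂0 : 0 ≤ B₂ := (norm_nonneg _).trans (hB₂ Complex.I (by simp [UpperHalf]))
  have hpt : ∀ y : ℝ, 1 ≤ y → ENNReal.ofReal ‖g₁ (y * Complex.I) * T (y * Complex.I)‖ ≤
      ENNReal.ofReal B₂ * ((‖F ((y : ℂ) * Complex.I)‖₊ : ℝ≥0∞) /
        L1Majorant μ L ((y : ℂ) * Complex.I)) := by
    intro y hy
    set w : ℂ := y * Complex.I with hw
    have hwim : w.im = y := by simp [hw]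
    have hw0 : 0 < w.im := by rw [hwim]; linarith
    by_cases h0 : g₁ w * T w = 0
    · simp [h0]
    obtain ⟨hg₁w, hTw⟩ := mul_ne_zero_iff.1 h0
    have hmaj : ENNReal.ofReal ‖T w‖ * L1Majorant μ L w ≤ ENNReal.ofReal (‖F₀ w‖ * w.im⁻¹) :=
      enorm_cauchyTransform_mul_L1Majorant_le hdb hg₀m hg₀u hL hann hF₀ hw0
    have hF₀w : F₀ w ≠ 0 := fun h => hTw
      (cauchyTransform_eq_zero_of_apply_eq_zero hdb hann hF₀ hw0 h)
    have hqw : ‖F₀ w‖ * ‖g₁ w‖ ≤ B₂ * ‖F w‖ := by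
      rw [← norm_mul, ← hq w hw0, norm_mul, mul_comm B₂]
      gcongr
      exact hB₂ w hw0
    have hpos : 0 < B₂ * ‖F w‖ :=
      (mul_pos (norm_pos_iff.2 hF₀w) (norm_pos_iff.2 hg₁w)).trans_le hqw
    change _ ≤ _ * (‖F w‖ₑ / _)
    rw [← mul_div_assoc, ← ofReal_norm, ← ENNReal.ofReal_mul hB₂0,
      ENNReal.le_div_iff_mul_le (Or.inr (ENNReal.ofReal_pos.2 hpos).ne')
        (Or.inr ENNReal.ofReal_ne_top), norm_mul, ENNReal.ofReal_mul (norm_nonneg _), mul_assoc]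
    refine (mul_le_mul_right hmaj _).trans ?_
    rw [← ENNReal.ofReal_mul (norm_nonneg _)]
    refine ENNReal.ofReal_le_ofReal (le_trans ?_ hqw)
    rw [mul_comm ‖F₀ w‖ ‖g₁ w‖]
    gcongr
    exact mul_le_of_le_one_right (norm_nonneg _) (inv_le_one_of_one_le₀ (hwim ▸ hy))
  have hdec : ∀ c : ℝ, ∀ᶠ y : ℝ in atTop, ‖(fun z => g₁ z * T z) (y * Complex.I)‖
      ≤ B₂ * Real.exp (-c * y) := by
    intro c
    filter_upwards [eventually_le_exp_of_limsup_eq_bot hbot c, eventually_ge_atTop 1] with y hy hy1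
    have := (hpt y hy1).trans (mul_le_mul_right hy _)
    rw [← ENNReal.ofReal_mul hB₂0] at this
    exact (ENNReal.ofReal_le_ofReal_iff (by positivity)).1 this
  have hHd : ∀ z : ℂ, 0 < z.im → DifferentiableAt ℂ (fun z => g₁ z * T z) z := fun z hz =>
    (hg₁d z hz).mul (hTd z hz)
  have hH0 := eq_zero_of_superexponential_decay hHd
    (B := B₁ * ∫ x : ℝ, ‖F₀ (x : ℂ) * g₀ x‖ ∂μ) (fun z hz => ?_) hdec
  · rcases eq_zero_or_eq_zero_of_mul_eq_zero_on_upperHalf hg₁d hTd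
      (eq_zero_on_upperHalf_of_eq_zero hHd hH0) with h | h
    exacts [hg₁0 h, hT0 h]
  · have hz0 := zero_lt_one.trans_le hz
    rw [norm_mul]
    gcongr
    · exact hB₁ z hz0
    · exact (norm_cauchyTransform_le (hI F₀ hF₀) hz0).trans
        (mul_le_of_le_one_right (integral_nonneg fun _ => norm_nonneg _) (inv_le_one_of_one_le₀ hz))
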